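/- If an infinitely divisible probability measure μ on [0, ∞) has an atom at the origin (μ({0}) > 0), then μ is compound Poisson: there exist λ > 0 and a probability measure ρ on [0, ∞) such that μ = e^{−λ} ∑_{k=0}^{∞} (λ^k / k!) ρ^{*k}, where ρ^{*k} denotes the k-fold convolution of ρ (with ρ^{*0} the Dirac mass at 0). -/

import Mathlib

open MeasureTheory

/-- Convolution of two measures on ℝ (law of the sum of independent random variables). -/
noncomputable def mconv (μ ν : Measure ℝ) : Measure ℝ :=
  (μ.prod ν).map (fun p => p.1 + p.2)

/-- n-fold convolution of ν (with the 0-fold convolution being the Dirac mass at 0). -/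
noncomputable def nmconv (ν : Measure ℝ) : ℕ → Measure ℝ
  | 0 => Measure.dirac 0
  | n + 1 => mconv ν (nmconv ν n)

open ProbabilityTheory Filter Topology Set

lemma mconv_eq_conv (μ ν : Measure ℝ) : mconv μ ν = μ.conv ν := rfl

instance isProbabilityMeasure_nmconv (ν : Measure ℝ) [IsProbabilityMeasure ν] (n : ℕ) :
    IsProbabilityMeasure (nmconv ν n) := by
  induction n with
  | zero => rw [nmconv]; infer_instance
  | succ n ih => rw [nmconv, mconv_eq_conv]; infer_instance

lemma charFun_nmconv (ν : Measure ℝ) [IsProbabilityMeasure ν] (n : ℕ) (t : ℝ) :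
    charFun (nmconv ν n) t = charFun ν t ^ n := by
  induction n with
  | zero => simp [nmconv, charFun_dirac]
  | succ n ih => rw [nmconv, mconv_eq_conv, charFun_conv, ih, pow_succ']

lemma ae_nonneg_of_measure_Ici {ν : Measure ℝ} [IsProbabilityMeasure ν]
    (h : ν (Ici 0) = 1) : ∀ᵐ x ∂ν, 0 ≤ x :=
  (mem_ae_iff_prob_eq_one measurableSet_Ici).2 h

lemma ae_nonneg_prod {μ ν : Measure ℝ} [SFinite μ] [SFinite ν]
    (hμ : ∀ᵐ x ∂μ, 0 ≤ x) (hν : ∀ᵐ x ∂ν, 0 ≤ x) :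
    ∀ᵐ z ∂(μ.prod ν), 0 ≤ z.1 ∧ 0 ≤ z.2 :=
  (Measure.quasiMeasurePreserving_fst.ae hμ).and (Measure.quasiMeasurePreserving_snd.ae hν)

lemma ae_nonneg_nmconv {ν : Measure ℝ} [IsProbabilityMeasure ν] (h : ∀ᵐ x ∂ν, 0 ≤ x) (n : ℕ) :
    ∀ᵐ x ∂(nmconv ν n), 0 ≤ x := by
  induction n with
  | zero => simp [nmconv, ae_dirac_eq]
  | succ n ih =>
    rw [nmconv, mconv, ae_map_iff (by fun_prop) measurableSet_Ici]
    filter_upwards [ae_nonneg_prod h ih] with z hz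
    exact add_nonneg hz.1 hz.2

lemma nmconv_singleton_zero {ν : Measure ℝ} [IsProbabilityMeasure ν] (h : ∀ᵐ x ∂ν, 0 ≤ x)
    (n : ℕ) : nmconv ν n {0} = ν {0} ^ n := by
  induction n with
  | zero => simp [nmconv]
  | succ n ih =>
    rw [nmconv, mconv, Measure.map_apply (by fun_prop) (measurableSet_singleton 0), pow_succ',
      ← ih, ← Measure.prod_prod]
    refine measure_congr ?_
    filter_upwards [ae_nonneg_prod h (ae_nonneg_nmconv h n)] with z hz
    refine propext ?_
    change z.1 + z.2 = 0 ↔ z.1 = 0 ∧ z.2 = 0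
    exact add_eq_zero_iff_of_nonneg hz.1 hz.2

lemma nmconv_Iic_le {ν : Measure ℝ} [IsProbabilityMeasure ν] (h : ∀ᵐ x ∂ν, 0 ≤ x)
    (n : ℕ) (K : ℝ) : nmconv ν n (Iic K) ≤ ν (Iic K) ^ n := by
  induction n with
  | zero => simpa using prob_le_one
  | succ n ih =>
    rw [nmconv, mconv, Measure.map_apply (by fun_prop) measurableSet_Iic, pow_succ']
    refine le_trans ?_ (mul_le_mul_right ih _)
    rw [← Measure.prod_prod]
    refine measure_mono_ae ?_
    filter_upwards [ae_nonneg_prod h (ae_nonneg_nmconv h n)] with z hz hK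
    change z.1 + z.2 ≤ K at hK
    exact ⟨show z.1 ≤ K by linarith [hz.2], show z.2 ≤ K by linarith [hz.1]⟩

lemma integrable_exp_mul_I (ν : Measure ℝ) [IsFiniteMeasure ν] (t : ℝ) :
    Integrable (fun x : ℝ => Complex.exp (t * x * Complex.I)) ν := by
  refine (integrable_const (1 : ℝ)).mono (by fun_prop) (.of_forall fun x => ?_)
  rw [← Complex.ofReal_mul, Complex.norm_exp_ofReal_mul_I]
  simp

lemma charFun_eq_atom_add_cond (ν : Measure ℝ) [IsProbabilityMeasure ν] (t : ℝ) :
    charFun ν t = ν.real {0} + (1 - ν.real {0}) * charFun ν[|{0}ᶜ] t := by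
  have hm : MeasurableSet ({0} : Set ℝ) := measurableSet_singleton 0
  rw [charFun_apply_real, charFun_apply_real, ← integral_add_compl hm (integrable_exp_mul_I ν t)]
  congr 1
  · simp [Measure.real]
  · rw [ProbabilityTheory.cond, integral_smul_measure, Complex.real_smul, ENNReal.toReal_inv]
    change _ = _ * (((ν.real {0}ᶜ)⁻¹ : ℝ) * _ : ℂ)
    rw [← Complex.ofReal_one, ← Complex.ofReal_sub, ← probReal_compl_eq_one_sub hm,
      Complex.ofReal_inv]
    by_cases h0 : ν.real {0}ᶜ = 0
    · rw [measureReal_eq_zero_iff] at h0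
      simp [Measure.restrict_eq_zero.2 h0]
    · rw [mul_inv_cancel_left₀ (Complex.ofReal_ne_zero.2 h0)]

/-- A uniform tail bound for the conditional law of a convolution root off the origin. -/
lemma cond_Ioi_le {ν μ : Measure ℝ} [IsProbabilityMeasure ν] (h : ∀ᵐ x ∂ν, 0 ≤ x)
    {n : ℕ} (hn : nmconv ν n = μ) (hatom : 0 < μ {0})
    {K : ℝ} (hK : 0 ≤ K) :
    (1 - μ.real {0}) * (ν[|{0}ᶜ]).real (Ioi K) ≤ - Real.log (μ.real (Iic K)) := by
  have hm : MeasurableSet ({0} : Set ℝ) := measurableSet_singleton 0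
  subst hn
  set q := ν.real {0} with hq
  have hp : (nmconv ν n).real {0} = q ^ n := by
    simp [Measure.real, nmconv_singleton_zero h, hq]
  have hle : (nmconv ν n).real (Iic K) ≤ ν.real (Iic K) ^ n := by
    have := ENNReal.toReal_mono (by finiteness) (nmconv_Iic_le h n K)
    simpa [Measure.real] using this
  have hpos : 0 < (nmconv ν n).real (Iic K) := by
    refine (ENNReal.toReal_pos hatom.ne' (by finiteness)).trans_le ?_
    exact measureReal_mono (by simpa using hK)
  set s := (ν[|{0}ᶜ]).real (Ioi K) with hs
  have hs0 : 0 ≤ s := measureReal_nonneg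
  have hq0 : 0 ≤ q := measureReal_nonneg
  have hIoi : ν.real (Ioi K) = (1 - q) * s := by
    have h1 : {0}ᶜ ∩ Ioi K = Ioi K := by
      refine inter_eq_right.2 fun x hx => ?_
      have : K < x := hx
      simp only [mem_compl_iff, mem_singleton_iff]
      linarith
    rw [hs, hq, ← probReal_compl_eq_one_sub hm, Measure.real, Measure.real,
      Measure.real, cond_apply hm.compl, h1, ENNReal.toReal_mul, ENNReal.toReal_inv, ← Measure.real,
      ← Measure.real]
    by_cases h0 : ν.real {0}ᶜ = 0
    · have : ν.real (Ioi K) ≤ ν.real {0}ᶜ := measureReal_mono (by rw [← h1]; exact inter_subset_left)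
      have h2 : 0 ≤ ν.real (Ioi K) := measureReal_nonneg
      rw [h0]; simp; linarith
    · field_simp
  have hIic : ν.real (Iic K) = 1 - (1 - q) * s := by
    rw [← hIoi, ← probReal_compl_eq_one_sub measurableSet_Ioi, compl_Ioi]
  have hexp : ν.real (Iic K) ^ n ≤ Real.exp (-(n * ((1 - q) * s))) := by
    have := Real.add_one_le_exp (-((1 - q) * s))
    calc ν.real (Iic K) ^ n ≤ Real.exp (-((1 - q) * s)) ^ n :=
          pow_le_pow_left₀ measureReal_nonneg (by rw [hIic]; linarith) n
      _ = _ := by rw [← Real.exp_nat_mul]; ring_nf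
  have hlog : Real.log ((nmconv ν n).real (Iic K)) ≤ -(n * ((1 - q) * s)) := by
    rw [← Real.log_exp (-(n * ((1 - q) * s)))]
    exact Real.log_le_log hpos (hle.trans hexp)
  have hbern : 1 - q ^ n ≤ n * (1 - q) := by
    have := one_add_mul_le_pow (a := q - 1) (by linarith) n
    rw [add_sub_cancel] at this
    linarith
  rw [hp]
  nlinarith [mul_le_mul_of_nonneg_right hbern hs0]

lemma norm_pow_sub_pow_le_of_norm_le_one {z w : ℂ} (hz : ‖z‖ ≤ 1) (hw : ‖w‖ ≤ 1) (n : ℕ) :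
    ‖z ^ n - w ^ n‖ ≤ n * ‖z - w‖ := by
  induction n with
  | zero => simp
  | succ n ih =>
    calc ‖z ^ (n + 1) - w ^ (n + 1)‖ = ‖(z ^ n - w ^ n) * z + w ^ n * (z - w)‖ := by ring_nf
      _ ≤ ‖z ^ n - w ^ n‖ * ‖z‖ + ‖w‖ ^ n * ‖z - w‖ := by
        rw [← norm_mul, ← norm_pow, ← norm_mul]; exact norm_add_le _ _
      _ ≤ ‖z ^ n - w ^ n‖ * 1 + 1 * ‖z - w‖ := by
        gcongr
        exact pow_le_one₀ (norm_nonneg _) hw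
      _ ≤ _ := by push_cast; linarith

lemma tendsto_nat_mul_one_sub_of_pow_eq {p : ℝ} (hp : 0 < p) {q : ℕ → ℝ} (hq : ∀ n, 0 ≤ q n)
    (h : ∀ᶠ n in atTop, q n ^ n = p) :
    Tendsto (fun n : ℕ => n * (1 - q n)) atTop (𝓝 (-Real.log p)) := by
  have hderiv : HasDerivAt (fun x : ℝ => Real.exp (Real.log p * x)) (Real.log p) 0 := by
    simpa using ((hasDerivAt_id (0 : ℝ)).const_mul (Real.log p)).exp
  have hinv : Tendsto (fun n : ℕ => ((n : ℝ))⁻¹) atTop (𝓝[>] 0) :=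
    tendsto_inv_atTop_nhdsGT_zero.comp tendsto_natCast_atTop_atTop
  refine ((hderiv.tendsto_slope_zero_right.comp hinv).neg).congr' ?_
  filter_upwards [h, eventually_gt_atTop 0] with n hn hn0
  have : Real.exp (Real.log p * (n : ℝ)⁻¹) = q n := by
    rw [mul_comm, ← Real.log_rpow hp, Real.exp_log (by positivity), ← hn,
      Real.pow_rpow_inv_natCast (hq n) hn0.ne']
  simp [this]
  ring

/-- The compound Poisson law with intensity `l` and jump distribution `ρ`. -/
noncomputable def compoundPoisson (ρ : Measure ℝ) (l : ℝ) : Measure ℝ :=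
  Measure.sum (fun k : ℕ =>
    ENNReal.ofReal (Real.exp (-l) * l ^ k / (k.factorial : ℝ)) • nmconv ρ k)

lemma isProbabilityMeasure_compoundPoisson (ρ : Measure ℝ) [IsProbabilityMeasure ρ] (l : ℝ)
    (hl : 0 ≤ l) :
    IsProbabilityMeasure (compoundPoisson ρ l) := by
  constructor
  have hs : HasSum (fun k : ℕ => Real.exp (-l) * l ^ k / (k.factorial : ℝ)) 1 := by
    have := (Real.exp_eq_exp_ℝ ▸ NormedSpace.expSeries_div_hasSum_exp (𝔸 := ℝ) l).mul_left
      (Real.exp (-l))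
    rw [← Real.exp_add, neg_add_cancel, Real.exp_zero] at this
    simpa [mul_div_assoc] using this
  rw [compoundPoisson, Measure.sum_apply _ MeasurableSet.univ]
  simp only [Measure.smul_apply, measure_univ, smul_eq_mul, mul_one]
  rw [← ENNReal.ofReal_tsum_of_nonneg (fun k => by positivity) hs.summable, hs.tsum_eq,
    ENNReal.ofReal_one]

lemma charFun_compoundPoisson (ρ : Measure ℝ) [IsProbabilityMeasure ρ] (l : ℝ)
    (hl : 0 ≤ l) (t : ℝ) :
    charFun (compoundPoisson ρ l) t = Complex.exp (l * (charFun ρ t - 1)) := by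
  have := isProbabilityMeasure_compoundPoisson ρ l hl
  have h1 := hasSum_integral_measure (integrable_exp_mul_I (compoundPoisson ρ l) t)
  rw [charFun_apply_real]
  refine h1.unique ?_
  have h2 := (Complex.exp_eq_exp_ℂ ▸ NormedSpace.expSeries_div_hasSum_exp (𝔸 := ℂ)
    (l * charFun ρ t)).mul_left (Complex.exp (-l))
  rw [← Complex.exp_add] at h2
  convert! h2 using 1
  · funext k
    rw [integral_smul_measure, ← charFun_apply_real, charFun_nmconv,
      ENNReal.toReal_ofReal (by positivity), Complex.real_smul]
    push_cast
    rw [mul_pow]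
    ring
  · ring_nf

/-- If an infinitely divisible probability measure on [0, ∞) has an atom at the origin,
then it is compound Poisson: μ = e^{-λ} ∑_{k≥0} (λ^k/k!) ρ^{*k} for some λ > 0 and
probability measure ρ on [0, ∞). -/
theorem stmt_6 (μ : Measure ℝ) [IsProbabilityMeasure μ] (hpos : μ (Set.Ici (0 : ℝ)) = 1)
    (hID : ∀ n : ℕ, 1 ≤ n → ∃ ν : Measure ℝ, IsProbabilityMeasure ν ∧
      ν (Set.Ici (0 : ℝ)) = 1 ∧ nmconv ν n = μ)
    (hatom : 0 < μ {0}) :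
    ∃ l : ℝ, 0 < l ∧ ∃ ρ : Measure ℝ, IsProbabilityMeasure ρ ∧ ρ (Set.Ici (0 : ℝ)) = 1 ∧
      μ = Measure.sum (fun k : ℕ =>
        ENNReal.ofReal (Real.exp (-l) * l ^ k / (k.factorial : ℝ)) • nmconv ρ k) := by
  by_cases hp1 : μ {0} = 1
  · refine ⟨1, one_pos, μ, inferInstance, hpos, ?_⟩
    have := isProbabilityMeasure_compoundPoisson μ 1 zero_le_one
    refine Measure.ext_of_charFun (funext fun t => ?_) (ν := compoundPoisson μ 1)
    have hc : charFun μ t = 1 := by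
      rw [charFun_eq_atom_add_cond]
      simp [Measure.real, hp1]
    rw [charFun_compoundPoisson μ 1 zero_le_one, hc]
    simp
  have hID' : ∀ n : ℕ, ∃ ν : Measure ℝ, IsProbabilityMeasure ν ∧
      ν (Ici (0 : ℝ)) = 1 ∧ nmconv ν (max n 1) = μ := fun n => hID _ (le_max_right _ _)
  choose ν hνP hν0 hνμ using hID'
  have hν := fun n => ae_nonneg_of_measure_Ici (hν0 n)
  set p := μ.real {0} with hp
  have hp_pos : 0 < p := ENNReal.toReal_pos hatom.ne' (by finiteness)
  have hp_lt : p < 1 := by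
    refine lt_of_le_of_ne measureReal_le_one fun h => hp1 ?_
    rwa [hp, Measure.real, ENNReal.toReal_eq_one_iff] at h
  have hqp : ∀ n, (ν n).real {0} ^ (max n 1) = p := fun n => by
    rw [hp, Measure.real, Measure.real, ← hνμ n, nmconv_singleton_zero (hν n), ENNReal.toReal_pow]
  have hcompl : ∀ n, ν n {0}ᶜ ≠ 0 := fun n h => by
    rw [prob_compl_eq_zero_iff (measurableSet_singleton 0)] at h
    have := hqp n
    rw [Measure.real, h, ENNReal.toReal_one, one_pow] at this
    exact hp_lt.ne this.symm
  have hρP : ∀ n, IsProbabilityMeasure (ν n)[|{0}ᶜ] := fun n =>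
    cond_isProbabilityMeasure (hcompl n)
  have hρ0 : ∀ n, (ν n)[|{0}ᶜ] (Ici 0) = 1 := fun n =>
    (mem_ae_iff_prob_eq_one measurableSet_Ici).1 (cond_absolutelyContinuous.ae_le (hν n))
  let P : ℕ → ProbabilityMeasure ℝ := fun n => ⟨(ν n)[|{0}ᶜ], hρP n⟩
  have htight : IsTightMeasureSet {((m : ProbabilityMeasure ℝ) : Measure ℝ) | m ∈ range P} := by
    rw [isTightMeasureSet_iff_exists_isCompact_measure_compl_le]
    intro ε hε
    have hlim : Tendsto (fun K => ENNReal.ofReal (-Real.log (μ.real (Iic K)) / (1 - p)))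
        atTop (𝓝 0) := by
      have h1 : Tendsto (fun K => μ.real (Iic K)) atTop (𝓝 1) := by
        simpa [Function.comp_def, Measure.real] using
          (ENNReal.tendsto_toReal (by finiteness)).comp (tendsto_measure_Iic_atTop μ)
      have h2 := ((Real.continuousAt_log one_ne_zero).tendsto.comp h1).neg.div_const (1 - p)
      simpa [Function.comp_def] using (ENNReal.continuous_ofReal.tendsto _).comp h2
    obtain ⟨K, hK, hK0⟩ := ((hlim.eventually_lt_const hε).and (eventually_ge_atTop 0)).exists
    refine ⟨Icc 0 K, isCompact_Icc, ?_⟩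
    rintro _ ⟨_, ⟨n, rfl⟩, rfl⟩
    change (ν n)[|{0}ᶜ] (Icc 0 K)ᶜ ≤ ε
    have hle : (ν n)[|{0}ᶜ] (Icc 0 K)ᶜ ≤ (ν n)[|{0}ᶜ] (Ioi K) := by
      refine measure_mono_ae ?_
      filter_upwards [cond_absolutelyContinuous.ae_le (hν n)] with x hx hx'
      exact not_le.1 fun h => hx' ⟨hx, h⟩
    refine hle.trans (le_trans ?_ hK.le)
    rw [← ENNReal.ofReal_toReal (measure_ne_top (ν n)[|{0}ᶜ] (Ioi K))]
    refine ENNReal.ofReal_le_ofReal ?_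
    rw [le_div_iff₀ (by linarith), mul_comm]
    exact cond_Ioi_le (hν n) (hνμ n) hatom hK0
  obtain ⟨ρ, -, hρ⟩ := (isCompact_closure_of_isTightMeasureSet htight).ultrafilter_le_nhds
    ((hyperfilter ℕ).map P) (by
      rw [le_principal_iff]
      exact Filter.mem_of_superset range_mem_map subset_closure)
  have hlim : Tendsto P (hyperfilter ℕ) (𝓝 ρ) := hρ
  have hU : (hyperfilter ℕ : Filter ℕ) ≤ atTop := Nat.hyperfilter_le_atTop
  have hl : 0 < -Real.log p := by linarith [Real.log_neg hp_pos hp_lt]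
  refine ⟨-Real.log p, hl, ρ, inferInstance, ?_, ?_⟩
  · refine le_antisymm prob_le_one ?_
    have := ProbabilityMeasure.limsup_measure_closed_le_of_tendsto hlim (isClosed_Ici (a := 0))
    refine le_trans (le_of_eq ?_) this
    change 1 = limsup (fun n => (ν n)[|{0}ᶜ] (Ici 0)) _
    simp [hρ0]
  have := isProbabilityMeasure_compoundPoisson (ρ : Measure ℝ) (-Real.log p) hl.le
  refine Measure.ext_of_charFun (funext fun t => ?_) (ν := compoundPoisson ρ (-Real.log p))
  rw [charFun_compoundPoisson (ρ : Measure ℝ) _ hl.le]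
  have hφ : Tendsto (fun n => charFun (ν n)[|{0}ᶜ] t) (hyperfilter ℕ) (𝓝 (charFun ρ t)) := by
    rw [ProbabilityMeasure.tendsto_iff_forall_integral_rclike_tendsto ℂ] at hlim
    simp_rw [charFun_eq_integral_innerProbChar]
    exact hlim (BoundedContinuousFunction.innerProbChar t)
  set q : ℕ → ℝ := fun n => (ν n).real {0} with hq
  have hq0 : ∀ n, 0 ≤ q n := fun n => measureReal_nonneg
  have hq1 : ∀ n, q n ≤ 1 := fun n => measureReal_le_one
  have hmax : ∀ᶠ n : ℕ in atTop, max n 1 = n := by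
    filter_upwards [eventually_ge_atTop 1] with n hn using max_eq_left hn
  have hnq : Tendsto (fun n : ℕ => n * (1 - q n)) atTop (𝓝 (-Real.log p)) := by
    refine tendsto_nat_mul_one_sub_of_pow_eq hp_pos hq0 ?_
    filter_upwards [hmax] with n hn
    rw [← hqp n, hn]
  have hbound : ∀ n, ∀ z : ℂ, ‖z‖ ≤ 1 → ‖(q n : ℂ) + (1 - q n) * z‖ ≤ 1 := fun n z hz => by
    have h1 : ‖(1 - q n : ℂ)‖ = 1 - q n := by
      rw [← Complex.ofReal_one, ← Complex.ofReal_sub, Complex.norm_of_nonneg (by linarith [hq1 n])]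
    calc _ ≤ ‖(q n : ℂ)‖ + ‖(1 - q n : ℂ) * z‖ := norm_add_le _ _
      _ ≤ q n + (1 - q n) * 1 := by
        rw [norm_mul, h1, Complex.norm_of_nonneg (hq0 n)]
        gcongr
        linarith [hq1 n]
      _ = 1 := by ring
  have hpow : Tendsto (fun n : ℕ => ((q n : ℂ) + (1 - q n) * charFun ρ t) ^ n) atTop
      (𝓝 (Complex.exp ((-Real.log p : ℝ) * (charFun ρ t - 1)))) := by
    have h1 : Tendsto (fun n : ℕ => (n : ℂ) * ((1 - q n) * (charFun ρ t - 1))) atTop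
        (𝓝 ((-Real.log p : ℝ) * (charFun ρ t - 1))) := by
      refine (((Complex.continuous_ofReal.tendsto _).comp hnq).mul_const
        (charFun ρ t - 1)).congr fun n => ?_
      simp [mul_assoc]
    refine (Complex.tendsto_one_add_pow_exp_of_tendsto h1).congr fun n => ?_
    ring
  have hdiff : Tendsto (fun n : ℕ => ((q n : ℂ) + (1 - q n) * charFun (ν n)[|{0}ᶜ] t) ^ n
      - ((q n : ℂ) + (1 - q n) * charFun ρ t) ^ n) (hyperfilter ℕ) (𝓝 0) := by
    have h1 := (hnq.mono_left hU).mul (tendsto_iff_norm_sub_tendsto_zero.1 hφ)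
    rw [mul_zero] at h1
    refine squeeze_zero_norm (fun n => ?_) h1
    refine (norm_pow_sub_pow_le_of_norm_le_one (hbound n _ (norm_charFun_le_one t))
      (hbound n _ (norm_charFun_le_one t)) n).trans (le_of_eq ?_)
    rw [add_sub_add_left_eq_sub, ← mul_sub, norm_mul, ← Complex.ofReal_one, ← Complex.ofReal_sub,
      Complex.norm_of_nonneg (by linarith [hq1 n]), mul_assoc]
  have hsum := hdiff.add (hpow.mono_left hU)
  rw [zero_add] at hsum
  refine tendsto_nhds_unique (tendsto_const_nhds.congr' ?_) hsum
  filter_upwards [hU hmax] with n hn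
  have hn' := hνμ n
  rw [hn] at hn'
  rw [sub_add_cancel, ← charFun_eq_atom_add_cond, ← charFun_nmconv, hn']
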